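/- Let x₁, x₂ ∈ ℝ, w ∈ (0,1), S(ρ) = w·exp(ρx₁) + (1−w)·exp(ρx₂), f(ρ) = log S(ρ), and define L(ρ) = f(ρ)/ρ for ρ ≠ 0 with L(0) = w·x₁ + (1−w)·x₂. Then L is differentiable at 0 with L'(0) = f''(0)/2 = w·(1−w)·(x₁ − x₂)²/2, and L'(0) ≤ Δ²/8 where Δ = |x₁ − x₂|. -/

import Mathlib

/-- `S(ρ) = w·exp(ρx₁) + (1−w)·exp(ρx₂)`. -/
noncomputable def Sfun (w x₁ x₂ ρ : ℝ) : ℝ :=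
  w * Real.exp (ρ * x₁) + (1 - w) * Real.exp (ρ * x₂)

/-- `f(ρ) = log S(ρ)`. -/
noncomputable def ffun (w x₁ x₂ ρ : ℝ) : ℝ :=
  Real.log (Sfun w x₁ x₂ ρ)

/-- `L(ρ) = f(ρ)/ρ` for `ρ ≠ 0`, with `L(0) = w·x₁ + (1−w)·x₂`. -/
noncomputable def Lfun (w x₁ x₂ ρ : ℝ) : ℝ :=
  if ρ = 0 then w * x₁ + (1 - w) * x₂ else ffun w x₁ x₂ ρ / ρ

lemma Sfun_pos_aux (x₁ x₂ w : ℝ) (hw : w ∈ Set.Ioo (0 : ℝ) 1) (ρ : ℝ) :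
    0 < Sfun w x₁ x₂ ρ := by
  have h1 := hw.1
  have h2 : 0 < 1 - w := by linarith [hw.2]
  unfold Sfun
  positivity

lemma hasDerivAt_expsum_aux (a b x₁ x₂ ρ : ℝ) :
    HasDerivAt (fun ρ : ℝ => a * Real.exp (ρ * x₁) + b * Real.exp (ρ * x₂))
      (a * x₁ * Real.exp (ρ * x₁) + b * x₂ * Real.exp (ρ * x₂)) ρ := by
  have h1 := (((hasDerivAt_id ρ).mul_const x₁).exp).const_mul a
  have h2 := (((hasDerivAt_id ρ).mul_const x₂).exp).const_mul b
  refine (h1.add h2).congr_deriv ?_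
  simp only [id]
  ring

/-- `L` is differentiable at `0` with `L'(0) = f''(0)/2 = w·(1−w)·(x₁−x₂)²/2`,
and `L'(0) ≤ Δ²/8` where `Δ = |x₁ − x₂|`. -/
theorem deriv_L_at_zero
    (x₁ x₂ w : ℝ) (hw : w ∈ Set.Ioo (0 : ℝ) 1)
    (Δ : ℝ) (hΔ : Δ = |x₁ - x₂|) :
    HasDerivAt (Lfun w x₁ x₂) (deriv (deriv (ffun w x₁ x₂)) 0 / 2) 0 ∧
    deriv (deriv (ffun w x₁ x₂)) 0 / 2 = w * (1 - w) * (x₁ - x₂) ^ 2 / 2 ∧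
    w * (1 - w) * (x₁ - x₂) ^ 2 / 2 ≤ Δ ^ 2 / 8 := by
  have hS := Sfun_pos_aux x₁ x₂ w hw
  have hf : ∀ ρ, HasDerivAt (ffun w x₁ x₂)
      ((w * x₁ * Real.exp (ρ * x₁) + (1 - w) * x₂ * Real.exp (ρ * x₂)) / Sfun w x₁ x₂ ρ) ρ :=
    fun ρ => (hasDerivAt_expsum_aux w (1 - w) x₁ x₂ ρ).log (hS ρ).ne'
  have hdf : deriv (ffun w x₁ x₂) = fun ρ =>
      (w * x₁ * Real.exp (ρ * x₁) + (1 - w) * x₂ * Real.exp (ρ * x₂)) / Sfun w x₁ x₂ ρ :=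
    funext fun ρ => (hf ρ).deriv
  have hS0 : Sfun w x₁ x₂ 0 = 1 := by simp [Sfun]
  have hf0 : ffun w x₁ x₂ 0 = 0 := by simp [ffun, hS0]
  have hd0 : deriv (ffun w x₁ x₂) 0 = w * x₁ + (1 - w) * x₂ := by
    rw [hdf]; simp [hS0]
  have hdd : HasDerivAt (deriv (ffun w x₁ x₂)) (w * (1 - w) * (x₁ - x₂) ^ 2) 0 := by
    rw [hdf]
    refine ((hasDerivAt_expsum_aux (w * x₁) ((1 - w) * x₂) x₁ x₂ 0).div
      (hasDerivAt_expsum_aux w (1 - w) x₁ x₂ 0) (hS 0).ne').congr_deriv ?_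
    simp
    ring
  refine ⟨?_, by rw [hdd.deriv], ?_⟩
  · rw [hdd.deriv, hasDerivAt_iff_tendsto_slope]
    have key : Filter.Tendsto
        (fun ρ => (ffun w x₁ x₂ ρ - ρ * (w * x₁ + (1 - w) * x₂)) / ρ ^ 2)
        (nhdsWithin 0 {0}ᶜ) (nhds (w * (1 - w) * (x₁ - x₂) ^ 2 / 2)) := by
      refine HasDerivAt.lhopital_zero_nhdsNE
        (f' := fun ρ => deriv (ffun w x₁ x₂) ρ - (w * x₁ + (1 - w) * x₂))
        (g' := fun ρ => 2 * ρ) ?_ ?_ ?_ ?_ ?_ ?_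
      · refine Filter.Eventually.of_forall fun ρ => ?_
        have := ((hf ρ).differentiableAt.hasDerivAt).sub
          ((hasDerivAt_id ρ).mul_const (w * x₁ + (1 - w) * x₂))
        exact this.congr_deriv (by simp)
      · refine Filter.Eventually.of_forall fun ρ => ?_
        simpa using hasDerivAt_pow 2 ρ
      · filter_upwards [self_mem_nhdsWithin] with ρ hρ
        have : ρ ≠ 0 := hρ
        positivity
      · have hc : ContinuousAt (fun ρ => ffun w x₁ x₂ ρ - ρ * (w * x₁ + (1 - w) * x₂)) 0 :=
          (hf 0).continuousAt.sub (by fun_prop)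
        have := hc.tendsto
        simp only [hf0, zero_mul, sub_zero] at this
        exact this.mono_left nhdsWithin_le_nhds
      · have hc : ContinuousAt (fun ρ : ℝ => ρ ^ 2) 0 := by fun_prop
        have := hc.tendsto
        simp only [ne_eq, OfNat.ofNat_ne_zero, not_false_eq_true, zero_pow] at this
        exact this.mono_left nhdsWithin_le_nhds
      · have := (hasDerivAt_iff_tendsto_slope.1 hdd).div_const 2
        refine this.congr fun ρ => ?_
        rw [slope_def_field, hd0, sub_zero, div_div, mul_comm ρ 2]
    refine key.congr' ?_
    filter_upwards [self_mem_nhdsWithin] with ρ hρ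
    have hρ' : ρ ≠ 0 := hρ
    rw [slope_def_field]
    simp only [Lfun, hρ', if_true, if_false]
    field_simp
    try ring
  · rw [hΔ, sq_abs]
    nlinarith [mul_nonneg (sq_nonneg (2 * w - 1)) (sq_nonneg (x₁ - x₂))]
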